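/- For every irreducible Markov chain on a finite state space with at least two states, T(1/2)/2 ≤ t_prod ≤ T(1/2), where t_prod = max{π(A)·E_x[τ_A] : x ∈ Ω, ∅ ≠ A ⊆ Ω}. -/

import Mathlib

/-- `P` is a row-stochastic transition matrix on the finite state space `Ω`. -/
def IsTransitionMatrix {Ω : Type*} [Fintype Ω] (P : Matrix Ω Ω ℝ) : Prop :=
  (∀ x y, 0 ≤ P x y) ∧ ∀ x, ∑ y, P x y = 1

/-- The chain is irreducible: any state can reach any other state. -/
def IsIrreducibleChain {Ω : Type*} [Fintype Ω] [DecidableEq Ω] (P : Matrix Ω Ω ℝ) : Prop :=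
  ∀ x y, ∃ n : ℕ, 0 < (P ^ n) x y

/-- `π` is a stationary distribution for `P`. -/
def IsStationaryDist {Ω : Type*} [Fintype Ω] (P : Matrix Ω Ω ℝ) (π : Ω → ℝ) : Prop :=
  (∀ x, 0 ≤ π x) ∧ (∑ x, π x = 1) ∧ ∀ y, ∑ x, π x * P x y = π y

/-- The expected hitting time `E_x[τ_A] = ∑_{t=0}^∞ ∑_{y ∉ A} Qᵗ(x,y)`, where `Q` is `P`
with rows and columns indexed by `A` replaced by zero. -/
noncomputable def hitTime {Ω : Type*} [Fintype Ω] [DecidableEq Ω]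
    (P : Matrix Ω Ω ℝ) (A : Finset Ω) (x : Ω) : ℝ :=
  ∑' t : ℕ, ∑ y ∈ Aᶜ, (((Matrix.of fun u v => if u ∈ A ∨ v ∈ A then (0:ℝ) else P u v)) ^ t) x y

/-- `T(α)`: the maximum expected hitting time of a set of stationary measure at least `α`. -/
noncomputable def Tfun {Ω : Type*} [Fintype Ω] [DecidableEq Ω]
    (P : Matrix Ω Ω ℝ) (π : Ω → ℝ) (α : ℝ) : ℝ :=
  sSup {r | ∃ (x : Ω) (A : Finset Ω), α ≤ ∑ a ∈ A, π a ∧ r = hitTime P A x}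

/-- `d⁺(A,B) = max_{x ∈ A} E_x[τ_B]`. -/
noncomputable def dplus {Ω : Type*} [Fintype Ω] [DecidableEq Ω]
    (P : Matrix Ω Ω ℝ) (A B : Finset Ω) : ℝ :=
  sSup {r | ∃ x ∈ A, r = hitTime P B x}

/-- `d⁻(A,B) = min_{x ∈ A} E_x[τ_B]`. -/
noncomputable def dminus {Ω : Type*} [Fintype Ω] [DecidableEq Ω]
    (P : Matrix Ω Ω ℝ) (A B : Finset Ω) : ℝ :=
  sInf {r | ∃ x ∈ A, r = hitTime P B x}

/-- `t_prod = max{π(A)·E_x[τ_A] : x ∈ Ω, ∅ ≠ A ⊆ Ω}`. -/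
noncomputable def tprodMC {Ω : Type*} [Fintype Ω] [DecidableEq Ω]
    (P : Matrix Ω Ω ℝ) (π : Ω → ℝ) : ℝ :=
  sSup {r | ∃ (x : Ω) (A : Finset Ω), A.Nonempty ∧ r = (∑ a ∈ A, π a) * hitTime P A x}

section aux
variable {Ω : Type*} [Fintype Ω] [DecidableEq Ω]

/-- Probability of not having hit `A` by time `t`. -/
noncomputable def surv (P : Matrix Ω Ω ℝ) (A : Finset Ω) (t : ℕ) (x : Ω) : ℝ :=
  ∑ y ∈ Aᶜ, (((Matrix.of fun u v => if u ∈ A ∨ v ∈ A then (0:ℝ) else P u v)) ^ t) x y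

lemma surv_zero (P : Matrix Ω Ω ℝ) (A : Finset Ω) (x : Ω) :
    surv P A 0 x = if x ∈ A then 0 else 1 := by
  simp only [surv, pow_zero, Matrix.one_apply, Finset.sum_ite_eq, Finset.mem_compl]
  split_ifs <;> simp_all

lemma surv_mem (P : Matrix Ω Ω ℝ) (A : Finset Ω) (t : ℕ) (x : Ω) (hx : x ∈ A) :
    surv P A t x = 0 := by
  cases t with
  | zero => simp [surv_zero, hx]
  | succ t => simp [surv, pow_succ', Matrix.mul_apply, hx]

lemma surv_succ (P : Matrix Ω Ω ℝ) (A : Finset Ω) (t : ℕ) (x : Ω) (hx : x ∉ A) :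
    surv P A (t+1) x = ∑ y, P x y * surv P A t y := by
  have : surv P A (t+1) x
      = ∑ z, (if z ∈ A then (0:ℝ) else P x z) * surv P A t z := by
    simp only [surv, pow_succ', Matrix.mul_apply]
    rw [Finset.sum_comm]
    refine Finset.sum_congr rfl fun z _ => ?_
    rw [Finset.mul_sum]
    simp [hx]
  rw [this]
  refine Finset.sum_congr rfl fun z _ => ?_
  split_ifs with hz
  · simp [surv_mem P A t z hz]
  · rfl

variable {P : Matrix Ω Ω ℝ}

lemma surv_nonneg (hP : IsTransitionMatrix P) (A : Finset Ω) (t : ℕ) (x : Ω) :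
    0 ≤ surv P A t x := by
  induction t generalizing x with
  | zero => rw [surv_zero]; split_ifs <;> norm_num
  | succ t ih =>
    by_cases hx : x ∈ A
    · rw [surv_mem P A _ x hx]
    · rw [surv_succ P A t x hx]
      exact Finset.sum_nonneg fun y _ => mul_nonneg (hP.1 x y) (ih y)

lemma surv_anti (hP : IsTransitionMatrix P) (A : Finset Ω) (x : Ω) :
    Antitone fun t => surv P A t x := by
  refine antitone_nat_of_succ_le fun t => ?_
  induction t generalizing x with
  | zero =>
    by_cases hx : x ∈ A
    · rw [surv_mem P A _ x hx, surv_mem P A _ x hx]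
    · rw [surv_succ P A 0 x hx, surv_zero, if_neg hx, ← hP.2 x]
      refine Finset.sum_le_sum fun y _ => ?_
      have := hP.1 x y
      rw [surv_zero]; split_ifs <;> simp [this]
  | succ t ih =>
    by_cases hx : x ∈ A
    · rw [surv_mem P A _ x hx, surv_mem P A _ x hx]
    · rw [surv_succ P A _ x hx, surv_succ P A t x hx]
      exact Finset.sum_le_sum fun y _ => mul_le_mul_of_nonneg_left (ih y) (hP.1 x y)

lemma surv_le_one (hP : IsTransitionMatrix P) (A : Finset Ω) (t : ℕ) (x : Ω) :
    surv P A t x ≤ 1 := by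
  refine (surv_anti hP A x (Nat.zero_le t)).trans ?_
  simp only [surv_zero]; split_ifs <;> norm_num

lemma pow_nonneg' (hP : IsTransitionMatrix P) (t : ℕ) (x y : Ω) : 0 ≤ (P ^ t) x y := by
  induction t generalizing x with
  | zero => simp only [pow_zero, Matrix.one_apply]; split_ifs <;> norm_num
  | succ t ih =>
    rw [pow_succ', Matrix.mul_apply]
    exact Finset.sum_nonneg fun z _ => mul_nonneg (hP.1 x z) (ih z)

lemma surv_add_pow_le (hP : IsTransitionMatrix P) (A : Finset Ω) (a : Ω) (ha : a ∈ A)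
    (t : ℕ) (x : Ω) : surv P A t x + (P ^ t) x a ≤ 1 := by
  induction t generalizing x with
  | zero =>
    rw [surv_zero]
    simp only [pow_zero, Matrix.one_apply]
    split_ifs <;> simp_all
  | succ t ih =>
    have h1 : surv P A (t+1) x ≤ ∑ y, P x y * surv P A t y := by
      by_cases hx : x ∈ A
      · rw [surv_mem P A _ x hx]
        exact Finset.sum_nonneg fun y _ => mul_nonneg (hP.1 x y) (surv_nonneg hP A t y)
      · rw [surv_succ P A t x hx]
    rw [pow_succ', Matrix.mul_apply]
    refine (add_le_add_left h1 _).trans ?_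
    rw [← Finset.sum_add_distrib, ← hP.2 x]
    refine Finset.sum_le_sum fun y _ => ?_
    rw [← mul_add]
    exact mul_le_of_le_one_right (hP.1 x y) (ih y)

lemma surv_summable (hP : IsTransitionMatrix P) (hirr : IsIrreducibleChain P)
    (A : Finset Ω) (hA : A.Nonempty) (x : Ω) : Summable fun t => surv P A t x := by
  obtain ⟨a, ha⟩ := hA
  choose n hn using fun x => hirr x a
  obtain ⟨N, hN⟩ : ∃ N, ∀ x, n x ≤ N :=
    ⟨Finset.univ.sup n, fun x => Finset.le_sup (Finset.mem_univ x)⟩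
  have hlt : ∀ x, surv P A N x < 1 := fun x => by
    have h1 := surv_add_pow_le hP A a ha (n x) x
    have h2 : surv P A N x ≤ surv P A (n x) x := surv_anti hP A x (hN x)
    have h3 := hn x
    linarith
  obtain ⟨x0, -, hx0⟩ := Finset.exists_max_image Finset.univ (surv P A N) ⟨x, Finset.mem_univ x⟩
  set c := surv P A N x0 with hc
  have hc0 : 0 ≤ c := surv_nonneg hP A N x0
  have hc1 : c < 1 := hlt x0
  have key : ∀ t x, surv P A (t + N) x ≤ c * surv P A t x := by
    intro t
    induction t with
    | zero =>
      intro x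
      by_cases hx : x ∈ A
      · rw [surv_mem P A _ x hx, surv_mem P A _ x hx, mul_zero]
      · rw [surv_zero, if_neg hx, mul_one, zero_add]
        exact hx0 x (Finset.mem_univ x)
    | succ t ih =>
      intro x
      by_cases hx : x ∈ A
      · rw [surv_mem P A _ x hx, surv_mem P A _ x hx, mul_zero]
      · rw [show t + 1 + N = (t + N) + 1 by ring, surv_succ P A _ x hx, surv_succ P A _ x hx,
          Finset.mul_sum]
        refine Finset.sum_le_sum fun y _ => ?_
        have := mul_le_mul_of_nonneg_left (ih y) (hP.1 x y)
        linarith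
  refine summable_of_sum_range_le (c := N / (1 - c)) (fun t => surv_nonneg hP A t x) fun K => ?_
  rw [le_div_iff₀ (by linarith)]
  have h1 : ∑ t ∈ Finset.range K, surv P A t x ≤ ∑ t ∈ Finset.range (N + K), surv P A t x :=
    Finset.sum_le_sum_of_subset_of_nonneg (Finset.range_mono (by omega))
      fun t _ _ => surv_nonneg hP A t x
  rw [Finset.sum_range_add] at h1
  have h2 : ∑ t ∈ Finset.range N, surv P A t x ≤ N := by
    refine (Finset.sum_le_sum fun t _ => surv_le_one hP A t x).trans ?_
    simp
  have h3 : ∑ t ∈ Finset.range K, surv P A (N + t) x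
      ≤ c * ∑ t ∈ Finset.range K, surv P A t x := by
    rw [Finset.mul_sum]
    refine Finset.sum_le_sum fun t _ => ?_
    rw [add_comm]; exact key t x
  linarith

lemma hitTime_eq (P : Matrix Ω Ω ℝ) (A : Finset Ω) (x : Ω) :
    hitTime P A x = ∑' t, surv P A t x := rfl

lemma hitTime_nonneg (hP : IsTransitionMatrix P) (A : Finset Ω) (x : Ω) : 0 ≤ hitTime P A x :=
  tsum_nonneg fun t => surv_nonneg hP A t x

lemma hitTime_mem (P : Matrix Ω Ω ℝ) (A : Finset Ω) (x : Ω) (hx : x ∈ A) :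
    hitTime P A x = 0 := by
  rw [hitTime_eq]; simp [surv_mem P A _ x hx]

lemma hitTime_step (hP : IsTransitionMatrix P) (hirr : IsIrreducibleChain P)
    (A : Finset Ω) (hA : A.Nonempty) (x : Ω) (hx : x ∉ A) :
    hitTime P A x = 1 + ∑ y, P x y * hitTime P A y := by
  rw [hitTime_eq, (surv_summable hP hirr A hA x).tsum_eq_zero_add, surv_zero, if_neg hx]
  congr 1
  simp only [surv_succ P A _ x hx, hitTime_eq]
  rw [Summable.tsum_finsetSum fun y _ => (surv_summable hP hirr A hA y).mul_left _]
  exact Finset.sum_congr rfl fun y _ => tsum_mul_left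

lemma max_principle (hP : IsTransitionMatrix P) (hirr : IsIrreducibleChain P)
    (C : Finset Ω) (hC : C.Nonempty) (ψ : Ω → ℝ) (h1 : ∀ x ∈ C, ψ x ≤ 0)
    (h2 : ∀ x, x ∉ C → ψ x = ∑ y, P x y * ψ y) (x : Ω) : ψ x ≤ 0 := by
  have key : ∀ t x, ψ x ≤ (∑ z, |ψ z|) * surv P C t x := by
    intro t
    induction t with
    | zero =>
      intro x
      by_cases hx : x ∈ C
      · rw [surv_mem P C _ x hx, mul_zero]; exact h1 x hx
      · rw [surv_zero, if_neg hx, mul_one]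
        exact (le_abs_self _).trans
          (Finset.single_le_sum (f := fun z => |ψ z|) (fun z _ => abs_nonneg _) (Finset.mem_univ x))
    | succ t ih =>
      intro x
      by_cases hx : x ∈ C
      · rw [surv_mem P C _ x hx, mul_zero]; exact h1 x hx
      · rw [surv_succ P C t x hx, h2 x hx, Finset.mul_sum]
        refine Finset.sum_le_sum fun y _ => ?_
        have := mul_le_mul_of_nonneg_left (ih y) (hP.1 x y)
        linarith
  have h0 := ((surv_summable hP hirr C hC x).tendsto_atTop_zero).const_mul (∑ z, |ψ z|)
  rw [mul_zero] at h0
  exact ge_of_tendsto' h0 fun t => key t x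

/-- If `h_A ≤ m` on `C`, then `h_A ≤ h_C + m`. -/
lemma hit_le_add (hP : IsTransitionMatrix P) (hirr : IsIrreducibleChain P)
    (A C : Finset Ω) (hA : A.Nonempty) (hAC : A ⊆ C) (m : ℝ)
    (hm : ∀ y ∈ C, hitTime P A y ≤ m) (x : Ω) : hitTime P A x ≤ hitTime P C x + m := by
  have hC : C.Nonempty := hA.mono hAC
  have := max_principle hP hirr C hC (fun x => hitTime P A x - hitTime P C x - m)
    (fun y hy => by
      have := hm y hy
      simp only [hitTime_mem P C y hy]; linarith)
    (fun y hy => by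
      have h1 : ∑ z, P y z * (hitTime P A z - hitTime P C z - m)
          = ∑ z, P y z * hitTime P A z - ∑ z, P y z * hitTime P C z - (∑ z, P y z) * m := by
        rw [Finset.sum_mul, ← Finset.sum_sub_distrib, ← Finset.sum_sub_distrib]
        exact Finset.sum_congr rfl fun z _ => by ring
      rw [h1, hP.2 y, hitTime_step hP hirr A hA y (fun h => hy (hAC h)),
        hitTime_step hP hirr C hC y hy]
      ring) x
  linarith

/-- The two-set inequality `π(A) m ≤ (1 - π(A)) D`. -/
lemma two_set (hP : IsTransitionMatrix P) (hirr : IsIrreducibleChain P) {π : Ω → ℝ}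
    (hπ : IsStationaryDist P π) (A B : Finset Ω) (hA : A.Nonempty) (hB : B.Nonempty)
    (m D : ℝ) (hm : 0 < m) (hD : 0 ≤ D) (hmB : ∀ y ∈ B, m ≤ hitTime P A y)
    (hDA : ∀ y ∈ A, hitTime P B y ≤ D) :
    (∑ a ∈ A, π a) * m ≤ (1 - ∑ a ∈ A, π a) * D := by
  set g := hitTime P B with hg
  set h := hitTime P A with hh
  set φ : Ω → ℝ := fun x => min (m * g x) (m * D - D * h x) with hφ
  have hdisj : ∀ y ∈ B, y ∉ A := fun y hy hyA => by
    have := hmB y hy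
    rw [hh, hitTime_mem P A y hyA] at this
    linarith
  have ub1 : ∀ x, x ∉ B → ∑ y, P x y * φ y ≤ m * g x - m := fun x hx => by
    have e := hitTime_step hP hirr B hB x hx
    rw [← hg] at e
    have : ∑ y, P x y * φ y ≤ m * ∑ y, P x y * g y := by
      rw [Finset.mul_sum]
      refine Finset.sum_le_sum fun y _ => ?_
      have := mul_le_mul_of_nonneg_left (min_le_left (m * g y) (m * D - D * h y)) (hP.1 x y)
      simp only [hφ]; linarith
    rw [e]; linarith
  have ub2 : ∀ x, x ∉ A → ∑ y, P x y * φ y ≤ m * D - D * h x + D := fun x hx => by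
    have e := hitTime_step hP hirr A hA x hx
    rw [← hh] at e
    have : ∑ y, P x y * φ y ≤ (∑ y, P x y) * (m * D) - D * ∑ y, P x y * h y := by
      rw [Finset.mul_sum, Finset.sum_mul, ← Finset.sum_sub_distrib]
      refine Finset.sum_le_sum fun y _ => ?_
      have := mul_le_mul_of_nonneg_left (min_le_right (m * g y) (m * D - D * h y)) (hP.1 x y)
      simp only [hφ]; linarith
    rw [hP.2 x] at this
    rw [e]; linarith
  have drift : ∀ x, ∑ y, P x y * φ y ≤ φ x + (if x ∈ A then -m - D else 0) + D := fun x => by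
    by_cases hxA : x ∈ A
    · have hxB : x ∉ B := fun hb => hdisj x hb hxA
      have e : φ x = m * g x := by
        simp only [hφ]
        apply min_eq_left
        have : h x = 0 := hitTime_mem P A x hxA
        rw [this, mul_zero, sub_zero]
        exact mul_le_mul_of_nonneg_left (hDA x hxA) hm.le
      rw [if_pos hxA, e]
      linarith [ub1 x hxB]
    · rw [if_neg hxA, add_zero]
      by_cases hxB : x ∈ B
      · have e : φ x = m * D - D * h x := by
          simp only [hφ]
          apply min_eq_right
          have : g x = 0 := hitTime_mem P B x hxB
          rw [this]
          nlinarith [hmB x hxB]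
        rw [e]; exact ub2 x hxA
      · have h1 := ub1 x hxB
        have h2 := ub2 x hxA
        rcases min_choice (m * g x) (m * D - D * h x) with e | e
        · simp only [hφ] at *
          rw [e]; linarith
        · simp only [hφ] at *
          rw [e]; linarith
  have inv : ∑ x, π x * ∑ y, P x y * φ y = ∑ y, π y * φ y := by
    simp only [Finset.mul_sum]
    rw [Finset.sum_comm]
    refine Finset.sum_congr rfl fun y _ => ?_
    rw [← hπ.2.2 y, Finset.sum_mul]
    exact Finset.sum_congr rfl fun x _ => by ring
  have tot : ∑ x, π x * ∑ y, P x y * φ y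
      ≤ ∑ x, π x * (φ x + (if x ∈ A then -m - D else 0) + D) :=
    Finset.sum_le_sum fun x _ => mul_le_mul_of_nonneg_left (drift x) (hπ.1 x)
  have ev : ∑ x, π x * (φ x + (if x ∈ A then -m - D else 0) + D)
      = ∑ x, π x * φ x + (∑ a ∈ A, π a) * (-m - D) + D := by
    simp only [mul_add, Finset.sum_add_distrib, mul_ite, mul_zero, Finset.sum_ite_mem,
      Finset.univ_inter, ← Finset.sum_mul, hπ.2.1, one_mul]
  rw [inv, ev] at tot
  linarith

/-- Existence of a median of `h` under `π`. -/
lemma exists_median {π : Ω → ℝ} (h0 : ∀ x, 0 ≤ π x) (h1 : ∑ x, π x = 1) (h : Ω → ℝ) :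
    ∃ y : Ω, 1/2 ≤ ∑ z ∈ Finset.univ.filter (fun z => h y ≤ h z), π z ∧
      1/2 ≤ ∑ z ∈ Finset.univ.filter (fun z => h z ≤ h y), π z := by
  have hne : (Finset.univ : Finset Ω).Nonempty := by
    by_contra hc
    rw [Finset.not_nonempty_iff_eq_empty] at hc
    rw [hc] at h1; simp at h1
  obtain ⟨y0, -, hy0⟩ := Finset.exists_min_image Finset.univ h hne
  have hS : (Finset.univ.filter fun y =>
      1/2 ≤ ∑ z ∈ Finset.univ.filter (fun z => h y ≤ h z), π z).Nonempty := by
    refine ⟨y0, ?_⟩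
    rw [Finset.mem_filter]
    refine ⟨Finset.mem_univ _, ?_⟩
    rw [Finset.filter_true_of_mem hy0, h1]; norm_num
  obtain ⟨y, hy, hmax⟩ := Finset.exists_max_image _ h hS
  rw [Finset.mem_filter] at hy
  refine ⟨y, hy.2, ?_⟩
  by_contra hlt
  push Not at hlt
  have hsplit := Finset.sum_filter_add_sum_filter_not Finset.univ (fun z => h z ≤ h y) π
  rw [h1] at hsplit
  have hgt : 1/2 < ∑ z ∈ Finset.univ.filter (fun z => ¬ h z ≤ h y), π z := by linarith
  have hne2 : (Finset.univ.filter (fun z => ¬ h z ≤ h y)).Nonempty := by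
    by_contra hc
    rw [Finset.not_nonempty_iff_eq_empty] at hc
    rw [hc] at hgt; norm_num at hgt
  obtain ⟨w, hw, hwmin⟩ := Finset.exists_min_image _ h hne2
  have hw' := (Finset.mem_filter.1 hw).2
  have : h w ≤ h y := hmax w (by
    rw [Finset.mem_filter]
    refine ⟨Finset.mem_univ _, hgt.le.trans ?_⟩
    refine Finset.sum_le_sum_of_subset_of_nonneg ?_ fun z _ _ => h0 z
    intro z hz
    rw [Finset.mem_filter]
    exact ⟨Finset.mem_univ _, hwmin z hz⟩)
  exact hw' this

lemma le_Tfun (P : Matrix Ω Ω ℝ) (π : Ω → ℝ) (α : ℝ) (x : Ω) (A : Finset Ω)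
    (hA : α ≤ ∑ a ∈ A, π a) : hitTime P A x ≤ Tfun P π α := by
  refine le_csSup (Set.Finite.bddAbove ?_) ⟨x, A, hA, rfl⟩
  refine (Set.finite_range fun p : Ω × Finset Ω => hitTime P p.2 p.1).subset ?_
  rintro r ⟨x, A, -, rfl⟩
  exact ⟨(x, A), rfl⟩

lemma le_tprod (P : Matrix Ω Ω ℝ) (π : Ω → ℝ) (x : Ω) (A : Finset Ω)
    (hA : A.Nonempty) : (∑ a ∈ A, π a) * hitTime P A x ≤ tprodMC P π := by
  refine le_csSup (Set.Finite.bddAbove ?_) ⟨x, A, hA, rfl⟩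
  refine (Set.finite_range fun p : Ω × Finset Ω =>
    (∑ a ∈ p.2, π a) * hitTime P p.2 p.1).subset ?_
  rintro r ⟨x, A, -, rfl⟩
  exact ⟨(x, A), rfl⟩

lemma nonempty_of_half {π : Ω → ℝ} {A : Finset Ω} (h : 1/2 ≤ ∑ a ∈ A, π a) : A.Nonempty := by
  by_contra hc
  rw [Finset.not_nonempty_iff_eq_empty] at hc
  rw [hc] at h; norm_num at h

lemma main_upper (hP : IsTransitionMatrix P) (hirr : IsIrreducibleChain P) {π : Ω → ℝ}
    (hπ : IsStationaryDist P π) (A : Finset Ω) (hA : A.Nonempty) (x : Ω) :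
    (∑ a ∈ A, π a) * hitTime P A x ≤ Tfun P π (1/2) := by
  obtain ⟨y, hB, hC⟩ := exists_median hπ.1 hπ.2.1 (hitTime P A)
  set B := Finset.univ.filter (fun z => hitTime P A y ≤ hitTime P A z)
  set C := Finset.univ.filter (fun z => hitTime P A z ≤ hitTime P A y)
  have hT0 : 0 ≤ Tfun P π (1/2) := (hitTime_nonneg hP C x).trans (le_Tfun P π _ x C hC)
  have hα0 : 0 ≤ ∑ a ∈ A, π a := Finset.sum_nonneg fun a _ => hπ.1 a
  have hα1 : ∑ a ∈ A, π a ≤ 1 := by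
    rw [← hπ.2.1]
    exact Finset.sum_le_sum_of_subset_of_nonneg (Finset.subset_univ A) fun a _ _ => hπ.1 a
  have hAC : A ⊆ C := fun a ha => by
    rw [Finset.mem_filter]
    refine ⟨Finset.mem_univ _, ?_⟩
    rw [hitTime_mem P A a ha]; exact hitTime_nonneg hP A y
  have h1 : hitTime P A x ≤ Tfun P π (1/2) + hitTime P A y :=
    (hit_le_add hP hirr A C hA hAC _ (fun z hz => (Finset.mem_filter.1 hz).2) x).trans
      (add_le_add_left (le_Tfun P π _ x C hC) _)
  have h2 : (∑ a ∈ A, π a) * hitTime P A y ≤ (1 - ∑ a ∈ A, π a) * Tfun P π (1/2) := by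
    rcases (hitTime_nonneg hP A y).eq_or_lt with h | h
    · rw [← h, mul_zero]; exact mul_nonneg (by linarith) hT0
    · exact two_set hP hirr hπ A B hA (nonempty_of_half hB) _ _ h hT0
        (fun z hz => (Finset.mem_filter.1 hz).2) (fun z _ => le_Tfun P π _ z B hB)
  have h3 := mul_le_mul_of_nonneg_left h1 hα0
  linarith

end aux

/-- For every irreducible Markov chain on a finite state space with at least two
states, `T(1/2)/2 ≤ t_prod ≤ T(1/2)`. -/
theorem tprod_equiv_T_half {Ω : Type*} [Fintype Ω] [DecidableEq Ω]
    (P : Matrix Ω Ω ℝ) (π : Ω → ℝ) (hcard : 2 ≤ Fintype.card Ω)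
    (hP : IsTransitionMatrix P) (hirr : IsIrreducibleChain P) (hπ : IsStationaryDist P π) :
    Tfun P π (1/2) / 2 ≤ tprodMC P π ∧ tprodMC P π ≤ Tfun P π (1/2) := by
  obtain ⟨x0⟩ : Nonempty Ω := Fintype.card_pos_iff.1 (by omega)
  constructor
  · rw [div_le_iff₀ (by norm_num)]
    refine csSup_le ⟨_, x0, Finset.univ, by rw [hπ.2.1]; norm_num, rfl⟩ ?_
    rintro r ⟨x, A, hA, rfl⟩
    have h1 := le_tprod P π x A (nonempty_of_half hA)
    have h2 := mul_le_mul_of_nonneg_right hA (hitTime_nonneg hP A x)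
    linarith
  · refine csSup_le ⟨_, x0, Finset.univ, ⟨x0, Finset.mem_univ _⟩, rfl⟩ ?_
    rintro r ⟨x, A, hA, rfl⟩
    exact main_upper hP hirr hπ A hA x
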